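/- For every n ≥ 1, every belief b and every action u ∈ U: |Q*_n(b,u) − Q_n(b,u)| ≤ φ δ_{n−1} + ε_p |V| R_max ( 1 + 3φ|O|/(1−φ) ). -/

import Mathlib

open Finset

noncomputable section

variable {S U V O : Type*}

/-- `b : S → ℝ` is a belief (probability distribution over states). -/
def IsBelief [Fintype S] (b : S → ℝ) : Prop :=
  (∀ s, 0 ≤ b s) ∧ ∑ s, b s = 1

/-- `P : S → V → ℝ` is a (mixed) strategy of the other agent. -/
def IsStrategy [Fintype V] (P : S → V → ℝ) : Prop :=
  (∀ s v, 0 ≤ P s v) ∧ ∀ s, ∑ v, P s v = 1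

/-- Expected immediate payoff `R_P(b,u) = Σ_{s,v} b(s) P(s,v) R(s,u,v)`. -/
def expR [Fintype S] [Fintype V] (R : S → U → V → ℝ) (P : S → V → ℝ)
    (b : S → ℝ) (u : U) : ℝ :=
  ∑ s, ∑ v, b s * P s v * R s u v

/-- Belief-state observation model
`Pr_P(v,o|b,u) = Σ_{s'} Z(s',u,o) Σ_s T(s,u,v,s') P(s,v) b(s)`. -/
def obsPr [Fintype S] (T : S → U → V → S → ℝ) (Z : S → U → O → ℝ)
    (P : S → V → ℝ) (b : S → ℝ) (u : U) (v : V) (o : O) : ℝ :=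
  ∑ s', Z s' u o * ∑ s, T s u v s' * P s v * b s

/-- Unnormalized belief update
`F_P(b,u,v,o)(s') = Z(s',u,o) Σ_s T(s,u,v,s') P(s,v) b(s)`. -/
def unnormUpd [Fintype S] (T : S → U → V → S → ℝ) (Z : S → U → O → ℝ)
    (P : S → V → ℝ) (b : S → ℝ) (u : U) (v : V) (o : O) (s' : S) : ℝ :=
  Z s' u o * ∑ s, T s u v s' * P s v * b s

/-- Normalized belief update `B_P(b,u,v,o)`. -/
def beliefUpd [Fintype S] (T : S → U → V → S → ℝ) (Z : S → U → O → ℝ)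
    (P : S → V → ℝ) (b : S → ℝ) (u : U) (v : V) (o : O) (s' : S) : ℝ :=
  unnormUpd T Z P b u v o s' / obsPr T Z P b u v o

/-- Value function of I-POMDP Lite: `V^P_0(b) = 0` and
`V^P_{n+1}(b) = max_u [ R_P(b,u) + φ Σ_{v,o} Pr_P(v,o|b,u) V^P_n(B_P(b,u,v,o)) ]`
(summands with `Pr_P(v,o|b,u) = 0` vanish since they are multiplied by `0`). -/
def valFun [Fintype S] [Fintype U] [Fintype V] [Fintype O] [Nonempty U]
    (T : S → U → V → S → ℝ) (Z : S → U → O → ℝ) (R : S → U → V → ℝ)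
    (P : S → V → ℝ) (φ : ℝ) : ℕ → (S → ℝ) → ℝ
  | 0, _ => 0
  | n + 1, b => ⨆ u : U, (expR R P b u +
      φ * ∑ v, ∑ o, obsPr T Z P b u v o * valFun T Z R P φ n (beliefUpd T Z P b u v o))

/-- Q-function of I-POMDP Lite: `qFun … n` is `Q^P_{n+1}`, i.e.
`Q^P_{n+1}(b,u) = R_P(b,u) + φ Σ_{v,o} Pr_P(v,o|b,u) V^P_n(B_P(b,u,v,o))`,
so that `V^P_{n+1}(b) = max_u (qFun … n b u)`. -/
def qFun [Fintype S] [Fintype U] [Fintype V] [Fintype O] [Nonempty U]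
    (T : S → U → V → S → ℝ) (Z : S → U → O → ℝ) (R : S → U → V → ℝ)
    (P : S → V → ℝ) (φ : ℝ) (n : ℕ) (b : S → ℝ) (u : U) : ℝ :=
  expR R P b u +
    φ * ∑ v, ∑ o, obsPr T Z P b u v o * valFun T Z R P φ n (beliefUpd T Z P b u v o)

/-- Prediction error `ε_p = max_{s,v} |Pr*(s,v) − Pr(s,v)|`. -/
def predErr [Fintype S] [Fintype V] [Nonempty S] [Nonempty V]
    (Pstar Ppred : S → V → ℝ) : ℝ :=
  ⨆ s : S, ⨆ v : V, |Pstar s v - Ppred s v|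

/-- Expected total reward of executing the (greedy) policy `π` under the true
strategy `Pstar`: `J_0(b) = 0` and
`J_{k+1}(b) = R_{P*}(b,π_{k+1}(b)) + φ Σ_{v,o} Pr_{P*}(v,o|b,π_{k+1}(b)) J_k(B_{P*}(b,π_{k+1}(b),v,o))`. -/
def execJ [Fintype S] [Fintype V] [Fintype O]
    (T : S → U → V → S → ℝ) (Z : S → U → O → ℝ) (R : S → U → V → ℝ)
    (Pstar : S → V → ℝ) (φ : ℝ) (π : ℕ → (S → ℝ) → U) : ℕ → (S → ℝ) → ℝ
  | 0, _ => 0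
  | k + 1, b =>
      expR R Pstar b (π (k + 1) b) +
        φ * ∑ v, ∑ o, obsPr T Z Pstar b (π (k + 1) b) v o *
          execJ T Z R Pstar φ π k (beliefUpd T Z Pstar b (π (k + 1) b) v o)

/-- Propagating a signed state-action weight through the transition and observation kernels
does not increase its total mass. -/
lemma sum_abs_kernel_le [Fintype S] [Fintype V] [Fintype O]
    {T : S → U → V → S → ℝ} {Z : S → U → O → ℝ}
    (hT0 : ∀ s u v s', 0 ≤ T s u v s') (hT1 : ∀ s u v, ∑ s', T s u v s' = 1)
    (hZ0 : ∀ s' u o, 0 ≤ Z s' u o) (hZ1 : ∀ s' u, ∑ o, Z s' u o = 1)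
    (x : S → V → ℝ) (u : U) :
    ∑ v, ∑ o, ∑ s', |Z s' u o * ∑ s, T s u v s' * x s v| ≤ ∑ s, ∑ v, |x s v| := by
  rw [Finset.sum_comm (s := (univ : Finset S))]
  refine Finset.sum_le_sum fun v _ => ?_
  calc ∑ o, ∑ s', |Z s' u o * ∑ s, T s u v s' * x s v|
      ≤ ∑ o, ∑ s', Z s' u o * ∑ s, T s u v s' * |x s v| := by
        refine Finset.sum_le_sum fun o _ => Finset.sum_le_sum fun s' _ => ?_
        rw [abs_mul, abs_of_nonneg (hZ0 s' u o)]
        refine mul_le_mul_of_nonneg_left ?_ (hZ0 s' u o)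
        refine (Finset.abs_sum_le_sum_abs _ _).trans (Finset.sum_le_sum fun s _ => ?_)
        rw [abs_mul, abs_of_nonneg (hT0 s u v s')]
    _ = ∑ s', ∑ s, T s u v s' * |x s v| := by
        rw [Finset.sum_comm]
        refine Finset.sum_congr rfl fun s' _ => ?_
        rw [← Finset.sum_mul, hZ1, one_mul]
    _ = ∑ s, |x s v| := by
        rw [Finset.sum_comm]
        refine Finset.sum_congr rfl fun s _ => ?_
        rw [← Finset.sum_mul, hT1, one_mul]

lemma abs_sum_mul_payoff_le [Fintype S] [Fintype V] {R : S → U → V → ℝ} {Rmax : ℝ}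
    (hR : ∀ s u v, 0 ≤ R s u v ∧ R s u v ≤ Rmax) (x : S → V → ℝ) (u : U) :
    |∑ s, ∑ v, x s v * R s u v| ≤ Rmax * ∑ s, ∑ v, |x s v| := by
  rw [Finset.mul_sum]
  refine (Finset.abs_sum_le_sum_abs _ _).trans (Finset.sum_le_sum fun s _ => ?_)
  rw [Finset.mul_sum]
  refine (Finset.abs_sum_le_sum_abs _ _).trans (Finset.sum_le_sum fun v _ => ?_)
  rw [abs_mul, abs_of_nonneg (hR s u v).1, mul_comm]
  exact mul_le_mul_of_nonneg_right (hR s u v).2 (abs_nonneg _)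

lemma abs_expR_sub_le [Fintype S] [Fintype V] {R : S → U → V → ℝ} {Rmax : ℝ}
    (hR : ∀ s u v, 0 ≤ R s u v ∧ R s u v ≤ Rmax) (P P' : S → V → ℝ) (b b' : S → ℝ) (u : U) :
    |expR R P b u - expR R P' b' u| ≤ Rmax * ∑ s, ∑ v, |P s v * b s - P' s v * b' s| := by
  have h := abs_sum_mul_payoff_le hR (fun s v => P s v * b s - P' s v * b' s) u
  convert h using 2
  simp only [expR, ← Finset.sum_sub_distrib]
  exact Finset.sum_congr rfl fun s _ => Finset.sum_congr rfl fun v _ => by ring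

lemma sum_abs_unnormUpd_sub_le [Fintype S] [Fintype V] [Fintype O]
    {T : S → U → V → S → ℝ} {Z : S → U → O → ℝ}
    (hT0 : ∀ s u v s', 0 ≤ T s u v s') (hT1 : ∀ s u v, ∑ s', T s u v s' = 1)
    (hZ0 : ∀ s' u o, 0 ≤ Z s' u o) (hZ1 : ∀ s' u, ∑ o, Z s' u o = 1)
    (P P' : S → V → ℝ) (b b' : S → ℝ) (u : U) :
    ∑ v, ∑ o, ∑ s', |unnormUpd T Z P b u v o s' - unnormUpd T Z P' b' u v o s'| ≤
      ∑ s, ∑ v, |P s v * b s - P' s v * b' s| := by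
  have h := sum_abs_kernel_le hT0 hT1 hZ0 hZ1 (fun s v => P s v * b s - P' s v * b' s) u
  convert h using 8
  simp only [unnormUpd, ← mul_sub, ← Finset.sum_sub_distrib]
  congr 1
  exact Finset.sum_congr rfl fun s _ => by ring

lemma unnormUpd_nonneg [Fintype S] {T : S → U → V → S → ℝ} {Z : S → U → O → ℝ}
    (hT0 : ∀ s u v s', 0 ≤ T s u v s') (hZ0 : ∀ s' u o, 0 ≤ Z s' u o)
    {P : S → V → ℝ} (hP : ∀ s v, 0 ≤ P s v) {b : S → ℝ} (hb : ∀ s, 0 ≤ b s)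
    (u : U) (v : V) (o : O) (s' : S) : 0 ≤ unnormUpd T Z P b u v o s' :=
  mul_nonneg (hZ0 _ _ _) (Finset.sum_nonneg fun _ _ =>
    mul_nonneg (mul_nonneg (hT0 _ _ _ _) (hP _ _)) (hb _))

lemma expR_smul [Fintype S] [Fintype V] (R : S → U → V → ℝ) (P : S → V → ℝ)
    (c : ℝ) (b : S → ℝ) (u : U) : expR R P (c • b) u = c * expR R P b u := by
  simp only [expR, Finset.mul_sum, Pi.smul_apply, smul_eq_mul, mul_assoc]

lemma unnormUpd_smul [Fintype S] (T : S → U → V → S → ℝ) (Z : S → U → O → ℝ)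
    (P : S → V → ℝ) (c : ℝ) (b : S → ℝ) (u : U) (v : V) (o : O) :
    unnormUpd T Z P (c • b) u v o = c • unnormUpd T Z P b u v o := by
  funext s'
  simp only [unnormUpd, Finset.mul_sum, Pi.smul_apply, smul_eq_mul]
  exact Finset.sum_congr rfl fun s _ => by ring

lemma obsPr_eq_sum_unnormUpd [Fintype S] (T : S → U → V → S → ℝ) (Z : S → U → O → ℝ)
    (P : S → V → ℝ) (b : S → ℝ) (u : U) (v : V) (o : O) :
    obsPr T Z P b u v o = ∑ s', unnormUpd T Z P b u v o s' := rfl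

lemma obsPr_smul [Fintype S] (T : S → U → V → S → ℝ) (Z : S → U → O → ℝ)
    (P : S → V → ℝ) (c : ℝ) (b : S → ℝ) (u : U) (v : V) (o : O) :
    obsPr T Z P (c • b) u v o = c * obsPr T Z P b u v o := by
  simp only [obsPr_eq_sum_unnormUpd, unnormUpd_smul, Finset.mul_sum, Pi.smul_apply, smul_eq_mul]

lemma beliefUpd_smul [Fintype S] (T : S → U → V → S → ℝ) (Z : S → U → O → ℝ)
    (P : S → V → ℝ) {c : ℝ} (hc : c ≠ 0) (b : S → ℝ) (u : U) (v : V) (o : O) :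
    beliefUpd T Z P (c • b) u v o = beliefUpd T Z P b u v o := by
  funext s'
  simp only [beliefUpd, obsPr_smul, unnormUpd_smul, Pi.smul_apply, smul_eq_mul]
  exact mul_div_mul_left _ _ hc

lemma valFun_succ [Fintype S] [Fintype U] [Fintype V] [Fintype O] [Nonempty U]
    (T : S → U → V → S → ℝ) (Z : S → U → O → ℝ) (R : S → U → V → ℝ)
    (P : S → V → ℝ) (φ : ℝ) (n : ℕ) (b : S → ℝ) :
    valFun T Z R P φ (n + 1) b = ⨆ u : U, qFun T Z R P φ n b u := rfl

lemma qFun_smul [Fintype S] [Fintype U] [Fintype V] [Fintype O] [Nonempty U]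
    (T : S → U → V → S → ℝ) (Z : S → U → O → ℝ) (R : S → U → V → ℝ)
    (P : S → V → ℝ) (φ : ℝ) (n : ℕ) (c : ℝ) (b : S → ℝ) (u : U) :
    qFun T Z R P φ n (c • b) u = c * qFun T Z R P φ n b u := by
  rcases eq_or_ne c 0 with rfl | hc
  · simp only [qFun, expR_smul, obsPr_smul, zero_mul, Finset.sum_const_zero, mul_zero, add_zero]
  · simp only [qFun, expR_smul, obsPr_smul, beliefUpd_smul T Z P hc, mul_assoc, ← Finset.mul_sum]
    ring

/-- The value function, extended to unnormalized beliefs, is positively homogeneous. -/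
lemma valFun_smul [Fintype S] [Fintype U] [Fintype V] [Fintype O] [Nonempty U]
    (T : S → U → V → S → ℝ) (Z : S → U → O → ℝ) (R : S → U → V → ℝ)
    (P : S → V → ℝ) (φ : ℝ) (n : ℕ) {c : ℝ} (hc : 0 ≤ c) (b : S → ℝ) :
    valFun T Z R P φ n (c • b) = c * valFun T Z R P φ n b := by
  cases n with
  | zero => simp [valFun]
  | succ n => simp only [valFun_succ, qFun_smul, Real.mul_iSup_of_nonneg hc]

lemma obsPr_smul_beliefUpd [Fintype S]
    {T : S → U → V → S → ℝ} {Z : S → U → O → ℝ}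
    (hT0 : ∀ s u v s', 0 ≤ T s u v s') (hZ0 : ∀ s' u o, 0 ≤ Z s' u o)
    {P : S → V → ℝ} (hP : ∀ s v, 0 ≤ P s v) {b : S → ℝ} (hb : ∀ s, 0 ≤ b s)
    (u : U) (v : V) (o : O) :
    obsPr T Z P b u v o • beliefUpd T Z P b u v o = unnormUpd T Z P b u v o := by
  funext s'
  simp only [beliefUpd, Pi.smul_apply, smul_eq_mul]
  refine mul_div_cancel_of_imp' fun h => ?_
  rw [obsPr_eq_sum_unnormUpd, Finset.sum_eq_zero_iff_of_nonneg
    fun s _ => unnormUpd_nonneg hT0 hZ0 hP hb u v o s] at h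
  exact h s' (mem_univ s')

lemma obsPr_nonneg [Fintype S] {T : S → U → V → S → ℝ} {Z : S → U → O → ℝ}
    (hT0 : ∀ s u v s', 0 ≤ T s u v s') (hZ0 : ∀ s' u o, 0 ≤ Z s' u o)
    {P : S → V → ℝ} (hP : ∀ s v, 0 ≤ P s v) {b : S → ℝ} (hb : ∀ s, 0 ≤ b s)
    (u : U) (v : V) (o : O) : 0 ≤ obsPr T Z P b u v o :=
  Finset.sum_nonneg fun s' _ => unnormUpd_nonneg hT0 hZ0 hP hb u v o s'

lemma isBelief_beliefUpd [Fintype S] {T : S → U → V → S → ℝ} {Z : S → U → O → ℝ}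
    (hT0 : ∀ s u v s', 0 ≤ T s u v s') (hZ0 : ∀ s' u o, 0 ≤ Z s' u o)
    {P : S → V → ℝ} (hP : ∀ s v, 0 ≤ P s v) {b : S → ℝ} (hb : ∀ s, 0 ≤ b s)
    {u : U} {v : V} {o : O} (h : obsPr T Z P b u v o ≠ 0) :
    IsBelief (beliefUpd T Z P b u v o) := by
  refine ⟨fun s' => div_nonneg (unnormUpd_nonneg hT0 hZ0 hP hb u v o s')
    (obsPr_nonneg hT0 hZ0 hP hb u v o), ?_⟩
  simp only [beliefUpd, ← Finset.sum_div, ← obsPr_eq_sum_unnormUpd]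
  exact div_self h

lemma sum_obsPr_le [Fintype S] [Fintype V] [Fintype O]
    {T : S → U → V → S → ℝ} {Z : S → U → O → ℝ}
    (hT0 : ∀ s u v s', 0 ≤ T s u v s') (hT1 : ∀ s u v, ∑ s', T s u v s' = 1)
    (hZ0 : ∀ s' u o, 0 ≤ Z s' u o) (hZ1 : ∀ s' u, ∑ o, Z s' u o = 1)
    {P : S → V → ℝ} (hP : IsStrategy P) {b : S → ℝ} (hb : IsBelief b) (u : U) :
    ∑ v, ∑ o, obsPr T Z P b u v o ≤ 1 := by
  have h := sum_abs_unnormUpd_sub_le hT0 hT1 hZ0 hZ1 P P b 0 u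
  have h0 : ∑ s, ∑ v, |P s v * b s - P s v * (0 : S → ℝ) s| = 1 := by
    simp only [Pi.zero_apply, mul_zero, sub_zero, abs_of_nonneg (mul_nonneg (hP.1 _ _) (hb.1 _)),
      ← Finset.sum_mul, hP.2, one_mul, hb.2]
  rw [h0] at h
  refine le_trans (le_of_eq ?_) h
  refine Finset.sum_congr rfl fun v _ => Finset.sum_congr rfl fun o _ =>
    Finset.sum_congr rfl fun s' _ => ?_
  have : unnormUpd T Z P 0 u v o s' = 0 := by simp [unnormUpd]
  rw [this, sub_zero, abs_of_nonneg (unnormUpd_nonneg hT0 hZ0 hP.1 hb.1 u v o s')]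
  rfl

lemma qFun_eq_unnormUpd [Fintype S] [Fintype U] [Fintype V] [Fintype O] [Nonempty U]
    {T : S → U → V → S → ℝ} {Z : S → U → O → ℝ} (R : S → U → V → ℝ)
    (hT0 : ∀ s u v s', 0 ≤ T s u v s') (hZ0 : ∀ s' u o, 0 ≤ Z s' u o)
    {P : S → V → ℝ} (hP : ∀ s v, 0 ≤ P s v) (φ : ℝ) (n : ℕ) {b : S → ℝ} (hb : ∀ s, 0 ≤ b s)
    (u : U) :
    qFun T Z R P φ n b u = expR R P b u +
      φ * ∑ v, ∑ o, valFun T Z R P φ n (unnormUpd T Z P b u v o) := by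
  simp only [qFun, ← valFun_smul T Z R P φ n (obsPr_nonneg hT0 hZ0 hP hb _ _ _),
    obsPr_smul_beliefUpd hT0 hZ0 hP hb]

/-- The value function is Lipschitz with constant `Rmax / (1 - φ)` for the `ℓ¹` distance on
unnormalized beliefs. -/
lemma abs_valFun_sub_le [Fintype S] [Fintype U] [Fintype V] [Fintype O] [Nonempty U]
    {T : S → U → V → S → ℝ} {Z : S → U → O → ℝ} {R : S → U → V → ℝ} {P : S → V → ℝ} {φ Rmax : ℝ}
    (hT0 : ∀ s u v s', 0 ≤ T s u v s') (hT1 : ∀ s u v, ∑ s', T s u v s' = 1)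
    (hZ0 : ∀ s' u o, 0 ≤ Z s' u o) (hZ1 : ∀ s' u, ∑ o, Z s' u o = 1)
    (hR : ∀ s u v, 0 ≤ R s u v ∧ R s u v ≤ Rmax) (hRmax : 0 ≤ Rmax)
    (hφ0 : 0 < φ) (hφ1 : φ < 1) (hP : IsStrategy P) (n : ℕ) :
    ∀ b c : S → ℝ, (∀ s, 0 ≤ b s) → (∀ s, 0 ≤ c s) →
      |valFun T Z R P φ n b - valFun T Z R P φ n c| ≤ Rmax / (1 - φ) * ∑ s, |b s - c s| := by
  have hK : 0 ≤ Rmax / (1 - φ) := div_nonneg hRmax (by linarith)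
  induction n with
  | zero =>
    intro b c _ _
    simp only [valFun, sub_self, abs_zero]
    exact mul_nonneg hK (Finset.sum_nonneg fun s _ => abs_nonneg _)
  | succ n ih =>
    have key : ∀ b c : S → ℝ, (∀ s, 0 ≤ b s) → (∀ s, 0 ≤ c s) →
        valFun T Z R P φ (n + 1) b ≤
          valFun T Z R P φ (n + 1) c + Rmax / (1 - φ) * ∑ s, |b s - c s| := by
      intro b c hb hc
      simp only [valFun_succ]
      refine ciSup_le fun u => ?_
      have hle : qFun T Z R P φ n c u ≤ ⨆ u, qFun T Z R P φ n c u :=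
        le_ciSup (Set.finite_range _).bddAbove u
      have hmass : ∑ s, ∑ v, |P s v * b s - P s v * c s| = ∑ s, |b s - c s| := by
        simp only [← mul_sub, abs_mul, abs_of_nonneg (hP.1 _ _), ← Finset.sum_mul, hP.2, one_mul]
      have h1 := (le_abs_self _).trans (abs_expR_sub_le hR P P b c u)
      have h2 := sum_abs_unnormUpd_sub_le hT0 hT1 hZ0 hZ1 P P b c u
      rw [hmass] at h1 h2
      have h3 : ∑ v, ∑ o, valFun T Z R P φ n (unnormUpd T Z P b u v o) -
          ∑ v, ∑ o, valFun T Z R P φ n (unnormUpd T Z P c u v o) ≤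
          Rmax / (1 - φ) * ∑ s, |b s - c s| := by
        refine le_trans ?_ (mul_le_mul_of_nonneg_left h2 hK)
        simp only [← Finset.sum_sub_distrib]
        rw [Finset.mul_sum]
        refine Finset.sum_le_sum fun v _ => ?_
        rw [Finset.mul_sum]
        refine Finset.sum_le_sum fun o _ => ?_
        exact (le_abs_self _).trans (ih _ _ (unnormUpd_nonneg hT0 hZ0 hP.1 hb u v o)
          (unnormUpd_nonneg hT0 hZ0 hP.1 hc u v o))
      have h4 := mul_le_mul_of_nonneg_left h3 hφ0.le
      rw [qFun_eq_unnormUpd R hT0 hZ0 hP.1 φ n hc] at hle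
      rw [qFun_eq_unnormUpd R hT0 hZ0 hP.1 φ n hb]
      have hKeq : Rmax + φ * (Rmax / (1 - φ)) = Rmax / (1 - φ) := by
        have : 1 - φ ≠ 0 := by linarith
        field_simp
        ring
      have h5 : Rmax * ∑ s, |b s - c s| + φ * (Rmax / (1 - φ) * ∑ s, |b s - c s|) =
          Rmax / (1 - φ) * ∑ s, |b s - c s| := by
        rw [← mul_assoc, ← add_mul, hKeq]
      linarith
    intro b c hb hc
    have h1 := key b c hb hc
    have h2 := key c b hc hb
    simp only [abs_sub_comm (c _) (b _)] at h2
    exact abs_le.2 ⟨by linarith, by linarith⟩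

lemma valFun_zero_belief [Fintype S] [Fintype U] [Fintype V] [Fintype O] [Nonempty U]
    (T : S → U → V → S → ℝ) (Z : S → U → O → ℝ) (R : S → U → V → ℝ)
    (P : S → V → ℝ) (φ : ℝ) (n : ℕ) : valFun T Z R P φ n 0 = 0 := by
  simpa using valFun_smul T Z R P φ n le_rfl (0 : S → ℝ)

lemma abs_valFun_le [Fintype S] [Fintype U] [Fintype V] [Fintype O] [Nonempty U]
    {T : S → U → V → S → ℝ} {Z : S → U → O → ℝ} {R : S → U → V → ℝ} {P : S → V → ℝ} {φ Rmax : ℝ}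
    (hT0 : ∀ s u v s', 0 ≤ T s u v s') (hT1 : ∀ s u v, ∑ s', T s u v s' = 1)
    (hZ0 : ∀ s' u o, 0 ≤ Z s' u o) (hZ1 : ∀ s' u, ∑ o, Z s' u o = 1)
    (hR : ∀ s u v, 0 ≤ R s u v ∧ R s u v ≤ Rmax) (hRmax : 0 ≤ Rmax)
    (hφ0 : 0 < φ) (hφ1 : φ < 1) (hP : IsStrategy P) (n : ℕ) {b : S → ℝ} (hb : IsBelief b) :
    |valFun T Z R P φ n b| ≤ Rmax / (1 - φ) := by
  have h := abs_valFun_sub_le hT0 hT1 hZ0 hZ1 hR hRmax hφ0 hφ1 hP n b 0 hb.1 (fun _ => le_rfl)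
  simpa only [valFun_zero_belief, sub_zero, Pi.zero_apply, abs_of_nonneg (hb.1 _), hb.2,
    mul_one] using h

lemma abs_sub_le_predErr [Fintype S] [Fintype V] [Nonempty S] [Nonempty V]
    (P P' : S → V → ℝ) (s : S) (v : V) : |P s v - P' s v| ≤ predErr P P' :=
  (le_ciSup (f := fun v => |P s v - P' s v|) (Set.finite_range _).bddAbove v).trans
    (le_ciSup (f := fun s => ⨆ v, |P s v - P' s v|) (Set.finite_range _).bddAbove s)

lemma sum_abs_strategy_sub_le [Fintype S] [Fintype V] [Nonempty S] [Nonempty V]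
    (P P' : S → V → ℝ) {b : S → ℝ} (hb : IsBelief b) :
    ∑ s, ∑ v, |P s v * b s - P' s v * b s| ≤ predErr P P' * Fintype.card V := by
  calc ∑ s, ∑ v, |P s v * b s - P' s v * b s|
      ≤ ∑ s, ∑ _v : V, predErr P P' * b s := by
        refine Finset.sum_le_sum fun s _ => Finset.sum_le_sum fun v _ => ?_
        rw [← sub_mul, abs_mul, abs_of_nonneg (hb.1 s)]
        exact mul_le_mul_of_nonneg_right (abs_sub_le_predErr P P' s v) (hb.1 s)
    _ = predErr P P' * Fintype.card V := by
        simp only [Finset.sum_const, card_univ, nsmul_eq_mul, ← Finset.mul_sum, hb.2]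
        ring

/-- **Proposition 3:** for every `n ≥ 1`, belief `b` and action `u`,
`|Q*_n(b,u) − Q_n(b,u)| ≤ φ δ_{n−1} + ε_p |V| R_max (1 + 3φ|O|/(1−φ))`. -/
theorem ipomdp_lite_q_diff_bound
    [Fintype S] [Fintype U] [Fintype V] [Fintype O]
    [Nonempty S] [Nonempty U] [Nonempty V] [Nonempty O]
    (T : S → U → V → S → ℝ) (Z : S → U → O → ℝ) (R : S → U → V → ℝ)
    (Pstar Ppred : S → V → ℝ) (φ : ℝ) (Rmax : ℝ)
    (hT0 : ∀ s u v s', 0 ≤ T s u v s') (hT1 : ∀ s u v, ∑ s', T s u v s' = 1)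
    (hZ0 : ∀ s' u o, 0 ≤ Z s' u o) (hZ1 : ∀ s' u, ∑ o, Z s' u o = 1)
    (hR : ∀ s u v, 0 ≤ R s u v ∧ R s u v ≤ Rmax)
    (hφ0 : 0 < φ) (hφ1 : φ < 1)
    (hPstar : IsStrategy Pstar) (hPpred : IsStrategy Ppred)
    (n : ℕ) (hn : 1 ≤ n) :
    ∀ b : S → ℝ, IsBelief b → ∀ u : U,
      |qFun T Z R Pstar φ (n - 1) b u - qFun T Z R Ppred φ (n - 1) b u| ≤
        φ * (⨆ b' : {b' : S → ℝ // IsBelief b'},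
            |valFun T Z R Pstar φ (n - 1) b'.1 - valFun T Z R Ppred φ (n - 1) b'.1|) +
          predErr Pstar Ppred * (Fintype.card V) * Rmax *
            (1 + 3 * φ * (Fintype.card O) / (1 - φ)) := by
  intro b hb u
  generalize n - 1 = m
  obtain ⟨s₀⟩ := ‹Nonempty S›
  obtain ⟨v₀⟩ := ‹Nonempty V›
  have : Nonempty S := ⟨s₀⟩
  have : Nonempty V := ⟨v₀⟩
  have hRmax : 0 ≤ Rmax := (hR s₀ u v₀).1.trans (hR s₀ u v₀).2
  have hK : 0 ≤ Rmax / (1 - φ) := div_nonneg hRmax (by linarith)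
  have hε : 0 ≤ predErr Pstar Ppred :=
    (abs_nonneg _).trans (abs_sub_le_predErr Pstar Ppred s₀ v₀)
  set δ : ℝ := ⨆ b' : {b' : S → ℝ // IsBelief b'},
    |valFun T Z R Pstar φ m b'.1 - valFun T Z R Ppred φ m b'.1| with hδ
  have hδ0 : 0 ≤ δ := Real.iSup_nonneg fun _ => abs_nonneg _
  have hδle : ∀ b' : S → ℝ, IsBelief b' →
      |valFun T Z R Pstar φ m b' - valFun T Z R Ppred φ m b'| ≤ δ := by
    intro b' hb'
    refine le_ciSup (f := fun b' : {b' : S → ℝ // IsBelief b'} =>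
      |valFun T Z R Pstar φ m b'.1 - valFun T Z R Ppred φ m b'.1|)
      ⟨Rmax / (1 - φ) + Rmax / (1 - φ), ?_⟩ ⟨b', hb'⟩
    rintro _ ⟨c, rfl⟩
    exact (abs_sub _ _).trans (add_le_add
      (abs_valFun_le hT0 hT1 hZ0 hZ1 hR hRmax hφ0 hφ1 hPstar m c.2)
      (abs_valFun_le hT0 hT1 hZ0 hZ1 hR hRmax hφ0 hφ1 hPpred m c.2))
  have hmass := sum_abs_strategy_sub_le Pstar Ppred hb
  have hpay := (abs_expR_sub_le hR Pstar Ppred b b u).trans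
    (mul_le_mul_of_nonneg_left hmass hRmax)
  have hupd := (sum_abs_unnormUpd_sub_le hT0 hT1 hZ0 hZ1 Pstar Ppred b b u).trans hmass
  have hsame : ∀ v o, |valFun T Z R Pstar φ m (unnormUpd T Z Pstar b u v o) -
      valFun T Z R Ppred φ m (unnormUpd T Z Pstar b u v o)| ≤ obsPr T Z Pstar b u v o * δ := by
    intro v o
    have hnn := obsPr_nonneg hT0 hZ0 hPstar.1 hb.1 u v o
    rw [← obsPr_smul_beliefUpd hT0 hZ0 hPstar.1 hb.1, valFun_smul _ _ _ _ _ _ hnn,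
      valFun_smul _ _ _ _ _ _ hnn, ← mul_sub, abs_mul, abs_of_nonneg hnn]
    rcases hnn.eq_or_lt with h | h
    · simp [← h]
    · exact mul_le_mul_of_nonneg_left
        (hδle _ (isBelief_beliefUpd hT0 hZ0 hPstar.1 hb.1 h.ne')) hnn
  have hfut : |∑ v, ∑ o, valFun T Z R Pstar φ m (unnormUpd T Z Pstar b u v o) -
      ∑ v, ∑ o, valFun T Z R Ppred φ m (unnormUpd T Z Ppred b u v o)| ≤
      δ + Rmax / (1 - φ) * (predErr Pstar Ppred * Fintype.card V) := by
    calc _ ≤ ∑ v, ∑ o, (obsPr T Z Pstar b u v o * δ + Rmax / (1 - φ) *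
            ∑ s', |unnormUpd T Z Pstar b u v o s' - unnormUpd T Z Ppred b u v o s'|) := by
          simp only [← Finset.sum_sub_distrib]
          refine (Finset.abs_sum_le_sum_abs _ _).trans (Finset.sum_le_sum fun v _ => ?_)
          refine (Finset.abs_sum_le_sum_abs _ _).trans (Finset.sum_le_sum fun o _ => ?_)
          exact (abs_sub_le _ _ _).trans (add_le_add (hsame v o)
            (abs_valFun_sub_le hT0 hT1 hZ0 hZ1 hR hRmax hφ0 hφ1 hPpred m _ _
              (unnormUpd_nonneg hT0 hZ0 hPstar.1 hb.1 u v o)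
              (unnormUpd_nonneg hT0 hZ0 hPpred.1 hb.1 u v o)))
      _ = (∑ v, ∑ o, obsPr T Z Pstar b u v o) * δ + Rmax / (1 - φ) *
            ∑ v, ∑ o, ∑ s', |unnormUpd T Z Pstar b u v o s' -
              unnormUpd T Z Ppred b u v o s'| := by
          simp only [Finset.sum_add_distrib, ← Finset.sum_mul, ← Finset.mul_sum]
      _ ≤ _ := add_le_add
          (mul_le_of_le_one_left hδ0 (sum_obsPr_le hT0 hT1 hZ0 hZ1 hPstar hb u))
          (mul_le_mul_of_nonneg_left hupd hK)
  rw [qFun_eq_unnormUpd R hT0 hZ0 hPstar.1 φ m hb.1, qFun_eq_unnormUpd R hT0 hZ0 hPpred.1 φ m hb.1,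
    add_sub_add_comm, ← mul_sub]
  refine (abs_add_le _ _).trans ?_
  rw [abs_mul, abs_of_pos hφ0]
  have hO : (1 : ℝ) ≤ Fintype.card O := by exact_mod_cast Fintype.card_pos
  have hslack : 0 ≤ φ * (Rmax / (1 - φ) * (predErr Pstar Ppred * Fintype.card V)) *
      (3 * Fintype.card O - 1) :=
    mul_nonneg (by positivity) (by linarith)
  have heq : predErr Pstar Ppred * Fintype.card V * Rmax *
      (1 + 3 * φ * Fintype.card O / (1 - φ)) =
      Rmax * (predErr Pstar Ppred * Fintype.card V) +
        φ * (Rmax / (1 - φ) * (predErr Pstar Ppred * Fintype.card V)) +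
        φ * (Rmax / (1 - φ) * (predErr Pstar Ppred * Fintype.card V)) *
          (3 * Fintype.card O - 1) := by
    ring
  have := mul_le_mul_of_nonneg_left hfut hφ0.le
  rw [heq]
  linarith
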